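/- arXiv:1710.04183 — 5 statements merged into one kernel-verified Lean document; each statement's English description precedes it below -/
import Mathlib

section
/- For every real α with 0 < α ≤ 1, every h > 0, and every natural number k ≥ 1, the weighted integral of the first hat basis function equals the first corrector weight: ∫_0^{h} (kh − s)^{α−1}·((h − s)/h) ds = (h^α/(α(α+1)))·((k−1)^{α+1} − k^α·(k−1−α)). -/
open MeasureTheory intervalIntegral

/-- For `0 < α ≤ 1`, `h > 0` and `k ≥ 1`, the weighted integral of the first
hat basis function equals the first corrector weight:
`∫_0^h (kh − s)^{α−1}·((h − s)/h) ds = (h^α/(α(α+1)))·((k−1)^{α+1} − k^α·(k−1−α))`. -/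
theorem corrector_weight_first
    (α h : ℝ) (hα : 0 < α) (hα1 : α ≤ 1) (hh : 0 < h)
    (k : ℕ) (hk : 1 ≤ k) :
    ∫ s in (0 : ℝ)..h, ((k : ℝ) * h - s) ^ (α - 1) * ((h - s) / h)
      = h ^ α / (α * (α + 1)) *
        (((k : ℝ) - 1) ^ (α + 1) - (k : ℝ) ^ α * ((k : ℝ) - 1 - α)) := by
  obtain ⟨m, hm, hm0⟩ : ∃ m : ℝ, (k : ℝ) = m + 1 ∧ 0 ≤ m :=
    ⟨(k : ℝ) - 1, by ring, by
      have : (1 : ℝ) ≤ k := by exact_mod_cast hk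
      linarith⟩
  rw [hm]
  have hmh : 0 ≤ m * h := by positivity
  have e1 : ∫ s in (0 : ℝ)..h, ((m + 1) * h - s) ^ (α - 1) * ((h - s) / h)
      = ∫ u in (m * h)..((m + 1) * h), u ^ (α - 1) * ((u - m * h) / h) := by
    have := integral_comp_sub_left (a := 0) (b := h)
      (fun u : ℝ => u ^ (α - 1) * ((u - m * h) / h)) ((m + 1) * h)
    rw [show (m + 1) * h - h = m * h by ring, sub_zero] at this
    rw [← this]
    congr 1
    funext s
    congr 2
    ring
  have e2 : ∫ u in (m * h)..((m + 1) * h), u ^ (α - 1) * ((u - m * h) / h)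
      = ∫ u in (m * h)..((m + 1) * h), ((1 / h) * u ^ α - m * u ^ (α - 1)) := by
    apply integral_congr
    intro u hu
    rw [Set.uIcc_of_le (by nlinarith)] at hu
    have hu0 : 0 ≤ u := hmh.trans hu.1
    have : u ^ α = u ^ (α - 1) * u := by
      have := Real.rpow_add_one' hu0 (y := α - 1) (by simpa using hα.ne')
      simpa using this
    simp only [this]
    field_simp
  rw [e1, e2, intervalIntegral.integral_sub
    ((intervalIntegrable_rpow' (by linarith)).const_mul _)
    ((intervalIntegrable_rpow' (by linarith)).const_mul _),
    intervalIntegral.integral_const_mul, intervalIntegral.integral_const_mul,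
    integral_rpow (Or.inl (by linarith)), integral_rpow (Or.inl (by linarith))]
  have hα' : α + 1 ≠ 0 := by linarith
  have hm1 : 0 ≤ m + 1 := by linarith
  rw [sub_add_cancel, add_sub_cancel_right, Real.mul_rpow hm0 hh.le, Real.mul_rpow hm1 hh.le,
    Real.mul_rpow hm0 hh.le, Real.mul_rpow hm1 hh.le,
    Real.rpow_add_one' hm0 hα', Real.rpow_add_one' hm1 hα', Real.rpow_add_one' hh.le hα']
  field_simp
  ring
end

section
/- For every real α with 0 < α ≤ 1, every h > 0, and all natural numbers j, k with 1 ≤ j ≤ k−1, the weighted integral of the interior hat basis function equals the interior corrector weight: ∫_{(j−1)h}^{jh} (kh − s)^{α−1}·((s − (j−1)h)/h) ds + ∫_{jh}^{(j+1)h} (kh − s)^{α−1}·(((j+1)h − s)/h) ds = (h^α/(α(α+1)))·((k+1−j)^{α+1} + (k−1−j)^{α+1} − 2(k−j)^{α+1}). -/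
open MeasureTheory intervalIntegral

theorem kernel_linear_integral (α a b p q : ℝ) (hα : 0 < α) (ha : 0 ≤ a) (hab : a ≤ b) :
    (∫ x in a..b, x ^ (α - 1) * (p + q * x))
      = p * ((b ^ α - a ^ α) / α) + q * ((b ^ (α + 1) - a ^ (α + 1)) / (α + 1)) := by
  have h1 : (∫ x in a..b, x ^ (α - 1) * (p + q * x))
      = ∫ x in a..b, (p * x ^ (α - 1) + q * x ^ α) := by
    apply intervalIntegral.integral_congr
    intro x hx
    rw [Set.uIcc_of_le hab] at hx
    have hx0 : 0 ≤ x := ha.trans hx.1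
    have h2 : x ^ α = x ^ (α - 1) * x := by
      rcases hx0.eq_or_lt with h0 | h0
      · rw [← h0, Real.zero_rpow hα.ne', mul_zero]
      · rw [Real.rpow_sub_one h0.ne']; field_simp
    simp only [h2]
    ring
  rw [h1, intervalIntegral.integral_add
    ((intervalIntegral.intervalIntegrable_rpow' (by linarith)).const_mul p)
    ((intervalIntegral.intervalIntegrable_rpow' (by linarith)).const_mul q),
    intervalIntegral.integral_const_mul, intervalIntegral.integral_const_mul,
    integral_rpow (Or.inl (by linarith)), integral_rpow (Or.inl (by linarith)), sub_add_cancel]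

/-- For `0 < α ≤ 1`, `h > 0` and naturals `1 ≤ j ≤ k − 1`, the weighted
integral of the interior hat basis function equals the interior corrector weight. -/
theorem corrector_weight_interior
    (α h : ℝ) (hα : 0 < α) (hα1 : α ≤ 1) (hh : 0 < h)
    (j k : ℕ) (hj : 1 ≤ j) (hjk : j ≤ k - 1) :
    (∫ s in (((j : ℝ) - 1) * h)..((j : ℝ) * h),
        ((k : ℝ) * h - s) ^ (α - 1) * ((s - ((j : ℝ) - 1) * h) / h))
      + (∫ s in ((j : ℝ) * h)..(((j : ℝ) + 1) * h),
          ((k : ℝ) * h - s) ^ (α - 1) * ((((j : ℝ) + 1) * h - s) / h))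
      = h ^ α / (α * (α + 1)) *
          (((k : ℝ) + 1 - j) ^ (α + 1) + ((k : ℝ) - 1 - j) ^ (α + 1)
            - 2 * ((k : ℝ) - j) ^ (α + 1)) := by
  have hkj : (j : ℝ) + 1 ≤ k := by
    have : j + 1 ≤ k := by omega
    exact_mod_cast this
  obtain ⟨n, hn⟩ : ∃ n : ℝ, n = (k : ℝ) - j := ⟨_, rfl⟩
  have hn1 : 1 ≤ n := by linarith
  have e1 : (∫ s in (((j : ℝ) - 1) * h)..((j : ℝ) * h),
        ((k : ℝ) * h - s) ^ (α - 1) * ((s - ((j : ℝ) - 1) * h) / h))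
      = ∫ x in (n * h)..((n + 1) * h), x ^ (α - 1) * ((n + 1) + (-1 / h) * x) := by
    have := intervalIntegral.integral_comp_sub_left (a := ((j : ℝ) - 1) * h) (b := (j : ℝ) * h)
      (fun x : ℝ => x ^ (α - 1) * ((n + 1) + (-1 / h) * x)) ((k : ℝ) * h)
    rw [show (n * h) = k * h - j * h by rw [hn]; ring,
      show ((n + 1) * h) = k * h - (j - 1) * h by rw [hn]; ring, ← this]
    congr 1
    funext s
    congr 1
    rw [hn]
    field_simp
    ring
  have e2 : (∫ s in ((j : ℝ) * h)..(((j : ℝ) + 1) * h),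
          ((k : ℝ) * h - s) ^ (α - 1) * ((((j : ℝ) + 1) * h - s) / h))
      = ∫ x in ((n - 1) * h)..(n * h), x ^ (α - 1) * (-(n - 1) + (1 / h) * x) := by
    have := intervalIntegral.integral_comp_sub_left (a := (j : ℝ) * h) (b := ((j : ℝ) + 1) * h)
      (fun x : ℝ => x ^ (α - 1) * (-(n - 1) + (1 / h) * x)) ((k : ℝ) * h)
    rw [show (n * h) = k * h - j * h by rw [hn]; ring,
      show ((n - 1) * h) = k * h - (j + 1) * h by rw [hn]; ring, ← this]
    congr 1
    funext s
    congr 1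
    rw [hn]
    field_simp
    ring
  have key : ∀ x : ℝ, 0 ≤ x → x ^ (α + 1) = x ^ α * x := by
    intro x hx
    rw [Real.rpow_add_one' hx (by linarith)]
  have m0 : 0 ≤ n - 1 := by linarith
  have m1 : 0 ≤ n := by linarith
  have m2 : 0 ≤ n + 1 := by linarith
  rw [e1, e2, kernel_linear_integral _ _ _ _ _ hα (by positivity) (by nlinarith),
    kernel_linear_integral _ _ _ _ _ hα (by positivity) (by nlinarith),
    show (k : ℝ) + 1 - j = n + 1 by linarith, show (k : ℝ) - 1 - j = n - 1 by linarith, ← hn,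
    key _ m0, key _ m1, key _ m2, key _ (mul_nonneg m0 hh.le), key _ (mul_nonneg m1 hh.le),
    key _ (mul_nonneg m2 hh.le), Real.mul_rpow m0 hh.le, Real.mul_rpow m1 hh.le,
    Real.mul_rpow m2 hh.le]
  have : α + 1 ≠ 0 := by linarith
  generalize (n + 1) ^ α = A
  generalize (n - 1) ^ α = B
  generalize n ^ α = C
  generalize h ^ α = H
  field_simp
  ring
end

section
/- For every real α with 0 < α ≤ 1, every h > 0, every natural number k ≥ 1, and all real constants c and d, the product trapezoidal quadrature is exact on affine integrands: ∑_{j=0}^{k} a_{j,k}·(c + d·jh) = ∫_0^{kh} (kh − s)^{α−1}·(c + d·s) ds, where a_{j,k} are the corrector weights. -/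
open MeasureTheory intervalIntegral Finset

/-- The corrector (product trapezoidal) weights `a_{j,k}` of the fractional
Adams–Bashforth–Moulton method. -/
noncomputable def correctorWeight (α h : ℝ) (k j : ℕ) : ℝ :=
  if j = 0 then
    h ^ α / (α * (α + 1)) * (((k : ℝ) - 1) ^ (α + 1) - (k : ℝ) ^ α * ((k : ℝ) - 1 - α))
  else if j = k then
    h ^ α / (α * (α + 1))
  else
    h ^ α / (α * (α + 1)) *
      (((k : ℝ) + 1 - j) ^ (α + 1) + ((k : ℝ) - 1 - j) ^ (α + 1)
        - 2 * ((k : ℝ) - j) ^ (α + 1))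

/-- Closed form of the summed second differences. -/
lemma sum_second_diff (f : ℕ → ℝ) (A B : ℝ) (m : ℕ) :
    ∑ i ∈ Finset.range m, (f (i + 2) + f i - 2 * f (i + 1)) * (A - B * ((i : ℝ) + 1))
      = A * (f (m + 1) - f m - f 1 + f 0)
        - B * (m * f (m + 1) - (m + 1) * f m + f 0) := by
  induction m with
  | zero => simp
  | succ m ih =>
    rw [Finset.sum_range_succ, ih]
    push_cast
    ring

lemma integral_affine_kernel (α T c d : ℝ) (hα : 0 < α) (hT : 0 < T) :
    ∫ s in (0 : ℝ)..T, (T - s) ^ (α - 1) * (c + d * s)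
      = (c + d * T) * (T ^ α / α) - d * (T ^ (α + 1) / (α + 1)) := by
  have h1 := intervalIntegral.integral_comp_sub_left (a := 0) (b := T)
    (fun u : ℝ => u ^ (α - 1) * (c + d * (T - u))) T
  simp only [sub_sub_cancel, sub_self, sub_zero] at h1
  rw [h1]
  have h2 : ∫ u in (0 : ℝ)..T, u ^ (α - 1) * (c + d * (T - u))
      = ∫ u in (0 : ℝ)..T, ((c + d * T) * u ^ (α - 1) - d * u ^ α) := by
    apply intervalIntegral.integral_congr_ae
    refine Filter.Eventually.of_forall fun u hu => ?_
    rw [Set.uIoc_of_le hT.le] at hu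
    have : u ^ α = u ^ (α - 1) * u := by
      rw [← Real.rpow_add_one hu.1.ne', sub_add_cancel]
    rw [this]
    ring
  rw [h2, intervalIntegral.integral_sub, intervalIntegral.integral_const_mul,
    intervalIntegral.integral_const_mul, integral_rpow (Or.inl (by linarith)),
    integral_rpow (Or.inl (by linarith)), sub_add_cancel, Real.zero_rpow hα.ne',
    Real.zero_rpow (by linarith), sub_zero, sub_zero]
  · exact (intervalIntegral.intervalIntegrable_rpow' (by linarith)).const_mul _
  · exact (intervalIntegral.intervalIntegrable_rpow' (by linarith)).const_mul _

/-- For `0 < α ≤ 1`, `h > 0`, `k ≥ 1` and real constants `c`, `d`, the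
product trapezoidal quadrature is exact on affine integrands:
`∑_{j=0}^{k} a_{j,k}·(c + d·jh) = ∫_0^{kh} (kh − s)^{α−1}·(c + d·s) ds`. -/
theorem corrector_quadrature_exact_on_affine
    (α h : ℝ) (hα : 0 < α) (hα1 : α ≤ 1) (hh : 0 < h)
    (k : ℕ) (hk : 1 ≤ k) (c d : ℝ) :
    (∑ j ∈ Finset.range (k + 1), correctorWeight α h k j * (c + d * ((j : ℝ) * h)))
      = ∫ s in (0 : ℝ)..((k : ℝ) * h), ((k : ℝ) * h - s) ^ (α - 1) * (c + d * s) := by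
  obtain ⟨n, rfl⟩ : ∃ n, k = n + 1 := ⟨k - 1, by omega⟩
  have hkpos : (0 : ℝ) < ((n + 1 : ℕ) : ℝ) := by positivity
  rw [integral_affine_kernel α _ c d hα (mul_pos hkpos hh)]
  rw [Finset.sum_range_succ, Finset.sum_range_succ']
  have hmid : ∑ j ∈ Finset.range n, correctorWeight α h (n + 1) (j + 1)
        * (c + d * (((j + 1 : ℕ) : ℝ) * h))
      = h ^ α / (α * (α + 1)) * ∑ i ∈ Finset.range n,
        ((fun i : ℕ => (i : ℝ) ^ (α + 1)) (i + 2) + (fun i : ℕ => (i : ℝ) ^ (α + 1)) i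
          - 2 * (fun i : ℕ => (i : ℝ) ^ (α + 1)) (i + 1))
          * ((c + d * (((n + 1 : ℕ) : ℝ) * h)) - d * h * ((i : ℝ) + 1)) := by
    rw [← Finset.sum_range_reflect, Finset.mul_sum]
    refine Finset.sum_congr rfl fun i hi => ?_
    have hi' := Finset.mem_range.mp hi
    obtain ⟨m, rfl⟩ : ∃ m, n = i + m + 1 := ⟨n - 1 - i, by omega⟩
    have e : i + m + 1 - 1 - i = m := by omega
    rw [e]
    unfold correctorWeight
    rw [if_neg (by omega), if_neg (by omega)]
    push_cast
    have e1 : (i : ℝ) + m + 1 + 1 + 1 - (m + 1) = i + 2 := by ring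
    have e2 : (i : ℝ) + m + 1 + 1 - 1 - (m + 1) = i := by ring
    have e3 : (i : ℝ) + m + 1 + 1 - (m + 1) = i + 1 := by ring
    rw [e1, e2, e3]
    ring
  rw [hmid, sum_second_diff (fun i : ℕ => (i : ℝ) ^ (α + 1))]
  unfold correctorWeight
  rw [if_pos rfl, if_neg (by omega), if_pos rfl]
  have hz : (0 : ℝ) ^ (α + 1) = 0 := Real.zero_rpow (by linarith)
  rw [Real.rpow_add_one (mul_pos hkpos hh).ne', Real.mul_rpow hkpos.le hh.le]
  have hk1 : ((n + 1 : ℕ) : ℝ) ^ (α + 1) = ((n + 1 : ℕ) : ℝ) ^ α * ((n + 1 : ℕ) : ℝ) :=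
    Real.rpow_add_one hkpos.ne' α
  simp only [hk1]
  push_cast
  rw [hz, Real.one_rpow, add_sub_cancel_right]
  have ha : α + 1 ≠ 0 := by linarith
  field_simp
  ring
end

section
/- For every real α with 0 < α ≤ 1 and every natural number k ≥ 1, one has (k−1)^{α+1} − k^α·(k−1−α) > 0; consequently, for every h > 0 the first corrector weight a_{0,k} = (h^α/(α(α+1)))·((k−1)^{α+1} − k^α·(k−1−α)) is strictly positive. -/
/-- For `0 < α ≤ 1` and `k ≥ 1`, one has
`(k−1)^{α+1} − k^α·(k−1−α) > 0`; consequently, for every `h > 0` the first corrector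
weight `a_{0,k} = (h^α/(α(α+1)))·((k−1)^{α+1} − k^α·(k−1−α))` is strictly positive. -/
theorem first_corrector_weight_pos
    (α : ℝ) (k : ℕ) (hα : 0 < α) (hα1 : α ≤ 1) (hk : 1 ≤ k) :
    0 < ((k : ℝ) - 1) ^ (α + 1) - (k : ℝ) ^ α * ((k : ℝ) - 1 - α) ∧
    ∀ h : ℝ, 0 < h →
      0 < h ^ α / (α * (α + 1)) *
            (((k : ℝ) - 1) ^ (α + 1) - (k : ℝ) ^ α * ((k : ℝ) - 1 - α)) := by
  have hk1 : (1 : ℝ) ≤ k := by exact_mod_cast hk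
  have hk0 : (0 : ℝ) < k := by linarith
  have hinv : (k : ℝ)⁻¹ ≤ 1 := inv_le_one_of_one_le₀ hk1
  have hB : 1 + (α + 1) * (-(k : ℝ)⁻¹) < (1 + (-(k : ℝ)⁻¹)) ^ (α + 1) :=
    one_add_mul_self_lt_rpow_one_add (by linarith) (by simp; omega) (by linarith)
  have hE : ((k : ℝ) - 1) ^ (α + 1) = (k : ℝ) ^ (α + 1) * (1 + (-(k : ℝ)⁻¹)) ^ (α + 1) := by
    rw [← Real.mul_rpow hk0.le (by linarith)]
    congr 1
    field_simp
    ring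
  have hF : (k : ℝ) ^ α * ((k : ℝ) - 1 - α) =
      (k : ℝ) ^ (α + 1) * (1 + (α + 1) * (-(k : ℝ)⁻¹)) := by
    rw [Real.rpow_add_one hk0.ne', mul_assoc]
    congr 1
    field_simp
    ring
  have main : 0 < ((k : ℝ) - 1) ^ (α + 1) - (k : ℝ) ^ α * ((k : ℝ) - 1 - α) := by
    rw [hE, hF, ← mul_sub]
    exact mul_pos (Real.rpow_pos_of_pos hk0 _) (by linarith)
  refine ⟨main, fun h hh => mul_pos ?_ main⟩
  exact div_pos (Real.rpow_pos_of_pos hh _) (by positivity)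
end

section
/- Let 0 < α ≤ 1, let 0 < t_k < t_{k+1} be reals, and let g : ℝ → ℝ be continuous on [0, t_k] with g(s) ≥ c for all s ∈ [0, t_k], where c > 0. Then the memory term neglected by the multi-step generalized differential transform method satisfies ∫_0^{t_k} (t_{k+1} − s)^{α−1}·g(s) ds ≥ c·(t_{k+1}^α − (t_{k+1} − t_k)^α)/α > 0; in particular, this neglected term is nonzero. -/
open MeasureTheory intervalIntegral

/-- Let `0 < α ≤ 1`, `0 < t_k < t_{k+1}`, and let `g` be continuous on
`[0, t_k]` with `g ≥ c > 0` there. Then the memory term neglected by the MSGDTM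
satisfies `∫_0^{t_k} (t_{k+1} − s)^{α−1}·g(s) ds ≥ c·(t_{k+1}^α − (t_{k+1} − t_k)^α)/α > 0`;
in particular, the neglected term is nonzero. -/
theorem neglected_memory_term_pos
    (α tk tk1 c : ℝ) (g : ℝ → ℝ)
    (hα : 0 < α) (hα1 : α ≤ 1) (htk : 0 < tk) (htk1 : tk < tk1)
    (hg : ContinuousOn g (Set.Icc 0 tk))
    (hgc : ∀ s ∈ Set.Icc (0 : ℝ) tk, c ≤ g s) (hc : 0 < c) :
    c * (tk1 ^ α - (tk1 - tk) ^ α) / α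
        ≤ ∫ s in (0 : ℝ)..tk, (tk1 - s) ^ (α - 1) * g s ∧
    0 < c * (tk1 ^ α - (tk1 - tk) ^ α) / α ∧
    (∫ s in (0 : ℝ)..tk, (tk1 - s) ^ (α - 1) * g s) ≠ 0 := by
  have hpos : 0 < c * (tk1 ^ α - (tk1 - tk) ^ α) / α := by
    have h : (tk1 - tk) ^ α < tk1 ^ α :=
      Real.rpow_lt_rpow (by linarith) (by linarith) hα
    exact div_pos (mul_pos hc (by linarith)) hα
  have hk : ContinuousOn (fun s : ℝ => (tk1 - s) ^ (α - 1)) (Set.Icc 0 tk) := by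
    apply ContinuousOn.rpow_const
    · fun_prop
    · intro s hs
      left
      have := hs.2
      intro h
      linarith
  have hint : ∫ s in (0 : ℝ)..tk, (tk1 - s) ^ (α - 1) * c
      = c * (tk1 ^ α - (tk1 - tk) ^ α) / α := by
    rw [intervalIntegral.integral_mul_const,
      intervalIntegral.integral_comp_sub_left (fun x : ℝ => x ^ (α - 1)) tk1,
      integral_rpow (Or.inl (by linarith))]
    simp only [sub_zero, sub_add_cancel]
    ring
  have hle : c * (tk1 ^ α - (tk1 - tk) ^ α) / α
      ≤ ∫ s in (0 : ℝ)..tk, (tk1 - s) ^ (α - 1) * g s := by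
    rw [← hint]
    apply intervalIntegral.integral_mono_on htk.le
    · apply ContinuousOn.intervalIntegrable
      rw [Set.uIcc_of_le htk.le]
      exact hk.mul continuousOn_const
    · apply ContinuousOn.intervalIntegrable
      rw [Set.uIcc_of_le htk.le]
      exact hk.mul hg
    · intro s hs
      have := hs.2
      exact mul_le_mul_of_nonneg_left (hgc s hs) (Real.rpow_nonneg (by linarith) _)
  exact ⟨hle, hpos, (lt_of_lt_of_le hpos hle).ne'⟩
end
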